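/- Let T′ be obtained from a rooted tree T by the leaf swap operation: for consecutive vertices v_1,…,v_k on a path from the root to a leaf with v_k not a leaf, w_1 a non-leaf child of v_1 (not on the path) with subtree B, and w_2 a leaf child of v_k, the edges v_1w_1 and v_kw_2 are replaced by v_1w_2 and v_kw_1 (so B and the leaf w_2 are swapped). Suppose there is a nonnegative eigenvector of C(T) for the eigenvalue ρ_C(T) whose entries corresponding to all leaf descendants of v_k are strictly positive. Then ρ_C(T′) > ρ_C(T). -/

import Mathlib

open Matrix

/-- A rooted tree on a finite vertex type `V`, encoded by its root and the
parent function: the root is its own parent, and iterating the parent function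
from any vertex eventually reaches the root.  (These conditions force the graph
whose edges join each non-root vertex to its parent to be a tree.) -/
structure TreeOn (V : Type) [Fintype V] [DecidableEq V] where
  root : V
  parent : V → V
  parent_root : parent root = root
  reaches : ∀ v, ∃ k, parent^[k] v = root

namespace TreeOn

variable {V : Type} [Fintype V] [DecidableEq V]

/-- `u` is a (weak) ancestor of `v`: some iterate of the parent function sends
`v` to `u`.  (Any ancestor is reached within `Fintype.card V` steps, so the
bound makes the predicate decidable without changing its meaning.) -/
def IsAncestor (T : TreeOn V) (u v : V) : Prop :=
  ∃ k, k ≤ Fintype.card V ∧ T.parent^[k] v = u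

instance (T : TreeOn V) (u v : V) : Decidable (T.IsAncestor u v) := by
  have h : T.IsAncestor u v ↔ ∃ k ∈ Finset.range (Fintype.card V + 1), T.parent^[k] v = u := by
    simp [IsAncestor, Nat.lt_succ_iff]
  rw [h]; infer_instance

/-- The level of a vertex: its distance to the root. -/
def level (T : TreeOn V) (v : V) : ℕ := Nat.find (T.reaches v)

/-- The ancestral level `ℓ(v ∨ w)`: the level of the lowest common ancestor
of `v` and `w`, i.e. the greatest level of a common ancestor. -/
def lcaLevel (T : TreeOn V) (v w : V) : ℕ :=
  (Finset.univ.filter fun u => T.IsAncestor u v ∧ T.IsAncestor u w).sup T.level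

/-- A leaf is a vertex with no children. -/
def IsLeaf (T : TreeOn V) (v : V) : Prop := ∀ u, T.parent u = v → u = v

instance (T : TreeOn V) : DecidablePred T.IsLeaf := fun v =>
  inferInstanceAs (Decidable (∀ u, T.parent u = v → u = v))

/-- The type of leaves of `T`. -/
abbrev Leaf (T : TreeOn V) := {v : V // T.IsLeaf v}

/-- The ancestral matrix `C(T)`, indexed by the leaves of `T`, whose
`(v, w)` entry is the ancestral level `ℓ(v ∨ w)`. -/
noncomputable def ancMatrix (T : TreeOn V) : Matrix T.Leaf T.Leaf ℝ :=
  Matrix.of fun v w => (T.lcaLevel v.1 w.1 : ℝ)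

/-- The ancestral spectral radius `ρ_C(T)`: the largest eigenvalue of `C(T)`. -/
noncomputable def rhoC (T : TreeOn V) : ℝ :=
  sSup {μ : ℝ | ∃ x : T.Leaf → ℝ, x ≠ 0 ∧ T.ancMatrix.mulVec x = μ • x}

/-- The underlying simple graph of the tree: each non-root vertex is joined
to its parent. -/
def graph (T : TreeOn V) : SimpleGraph V :=
  SimpleGraph.fromRel fun u v => T.parent u = v ∧ u ≠ v

/-- The number of children (outdegree) of a vertex. -/
def childCount (T : TreeOn V) (v : V) : ℕ :=
  (Finset.univ.filter fun u => T.parent u = v ∧ u ≠ v).card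

end TreeOn

namespace TreeOn

variable {V : Type} [Fintype V] [DecidableEq V]

lemma iter_root (T : TreeOn V) (n : ℕ) : T.parent^[n] T.root = T.root :=
  Function.iterate_fixed T.parent_root n

lemma iter_level (T : TreeOn V) (z : V) : T.parent^[T.level z] z = T.root :=
  Nat.find_spec (T.reaches z)

lemma level_le (T : TreeOn V) {z : V} {n : ℕ} (h : T.parent^[n] z = T.root) : T.level z ≤ n :=
  Nat.find_min' _ h

lemma level_root (T : TreeOn V) : T.level T.root = 0 :=
  Nat.le_zero.1 (T.level_le (n := 0) rfl)

lemma level_iter (T : TreeOn V) (z : V) (i : ℕ) :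
    T.level (T.parent^[i] z) = T.level z - i := by
  apply le_antisymm
  · apply level_le
    rw [← Function.iterate_add_apply]
    rcases le_total i (T.level z) with h | h
    · rw [Nat.sub_add_cancel h, iter_level]
    · have : T.level z - i + i = (i - T.level z) + T.level z := by omega
      rw [this, Function.iterate_add_apply, iter_level, iter_root]
  · have := T.level_le (z := z) (n := T.level (T.parent^[i] z) + i)
      (by rw [Function.iterate_add_apply, iter_level])
    omega

lemma iter_inj (T : TreeOn V) (z : V) : Set.InjOn (fun i => T.parent^[i] z)
    (Set.Iic (T.level z)) := by
  intro i hi j hj h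
  have := congrArg T.level h
  simp only [level_iter, Set.mem_Iic] at *
  omega

lemma level_lt_card (T : TreeOn V) (z : V) : T.level z < Fintype.card V := by
  have h := Finset.card_le_card_of_injOn (s := Finset.Iic (T.level z)) (t := Finset.univ)
    (fun i => T.parent^[i] z) (by simp) (by simpa using T.iter_inj z)
  simp at h
  exact h

lemma anc_iff (T : TreeOn V) (u z : V) : T.IsAncestor u z ↔ ∃ n, T.parent^[n] z = u := by
  constructor
  · rintro ⟨n, _, h⟩; exact ⟨n, h⟩
  · rintro ⟨n, h⟩
    have hc := T.level_lt_card z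
    rcases le_total n (T.level z) with h1 | h1
    · exact ⟨n, by omega, h⟩
    · refine ⟨T.level z, hc.le, ?_⟩
      rw [iter_level, ← h]
      have : n = (n - T.level z) + T.level z := by omega
      rw [this, Function.iterate_add_apply, iter_level, iter_root]

lemma anc_refl (T : TreeOn V) (u : V) : T.IsAncestor u u := (T.anc_iff u u).2 ⟨0, rfl⟩

lemma anc_root (T : TreeOn V) (u : V) : T.IsAncestor T.root u :=
  (T.anc_iff _ u).2 (T.reaches u)

lemma anc_trans (T : TreeOn V) {u x y : V} (h : T.IsAncestor u x) (h' : T.IsAncestor x y) :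
    T.IsAncestor u y := by
  rw [anc_iff] at *
  obtain ⟨n, rfl⟩ := h
  obtain ⟨m, rfl⟩ := h'
  exact ⟨n + m, Function.iterate_add_apply _ _ _ _⟩

lemma anc_step (T : TreeOn V) (u x : V) :
    T.IsAncestor u x ↔ u = x ∨ T.IsAncestor u (T.parent x) := by
  simp only [anc_iff]
  constructor
  · rintro ⟨n, rfl⟩
    cases n with
    | zero => left; rfl
    | succ n => right; exact ⟨n, rfl⟩
  · rintro (rfl | ⟨n, rfl⟩)
    · exact ⟨0, rfl⟩
    · exact ⟨n + 1, rfl⟩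

lemma anc_level (T : TreeOn V) {u x : V} (h : T.IsAncestor u x) : T.level u ≤ T.level x := by
  obtain ⟨n, rfl⟩ := (T.anc_iff _ _).1 h
  rw [level_iter]; omega

lemma anc_eq_of_level (T : TreeOn V) {u x : V} (h : T.IsAncestor u x)
    (hl : T.level x ≤ T.level u) : u = x := by
  obtain ⟨n, rfl⟩ := (T.anc_iff _ _).1 h
  rw [level_iter] at hl
  rcases Nat.eq_zero_or_pos n with rfl | hn
  · rfl
  · have h0 : T.level x = 0 := by omega
    have : x = T.root := by have := T.iter_level x; rwa [h0] at this
    rw [this, iter_root]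

lemma anc_antisymm (T : TreeOn V) {u x : V} (h : T.IsAncestor u x) (h' : T.IsAncestor x u) :
    u = x := T.anc_eq_of_level h (T.anc_level h')

lemma anc_total (T : TreeOn V) {u m x : V} (h : T.IsAncestor u x) (h' : T.IsAncestor m x) :
    T.IsAncestor u m ∨ T.IsAncestor m u := by
  rw [anc_iff] at h h'
  obtain ⟨i, rfl⟩ := h
  obtain ⟨j, rfl⟩ := h'
  simp only [anc_iff]
  rcases le_total i j with hij | hij
  · right; refine ⟨j - i, ?_⟩
    rw [← Function.iterate_add_apply, Nat.sub_add_cancel hij]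
  · left; refine ⟨i - j, ?_⟩
    rw [← Function.iterate_add_apply, Nat.sub_add_cancel hij]

lemma anc_root_iff (T : TreeOn V) (u : V) : T.IsAncestor u T.root ↔ u = T.root :=
  ⟨fun h => T.anc_antisymm h (T.anc_root u), fun h => h ▸ T.anc_refl u⟩

/-- induction along the parent function -/
lemma parent_induction (T : TreeOn V) {p : V → Prop} (h0 : p T.root)
    (hs : ∀ x, x ≠ T.root → p (T.parent x) → p x) (x : V) : p x := by
  obtain ⟨n, hn⟩ := T.reaches x
  induction n generalizing x with
  | zero => simp at hn; exact hn ▸ h0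
  | succ n ih =>
    by_cases hx : x = T.root
    · exact hx ▸ h0
    · exact hs x hx (ih _ hn)

lemma level_eq_card (T : TreeOn V) (z : V) :
    T.level z = ((Finset.univ.erase T.root).filter fun u => T.IsAncestor u z).card := by
  have : ((Finset.univ.erase T.root).filter fun u => T.IsAncestor u z)
      = (Finset.range (T.level z)).image (fun i => T.parent^[i] z) := by
    ext u
    simp only [Finset.mem_filter, Finset.mem_erase, Finset.mem_univ, and_true, Finset.mem_image,
      Finset.mem_range]
    constructor
    · rintro ⟨hu, h⟩
      obtain ⟨n, rfl⟩ := (T.anc_iff _ _).1 h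
      refine ⟨n, ?_, rfl⟩
      by_contra hn
      apply hu
      have : n = (n - T.level z) + T.level z := by omega
      rw [this, Function.iterate_add_apply, iter_level, iter_root]
    · rintro ⟨i, hi, rfl⟩
      refine ⟨fun h => ?_, (T.anc_iff _ _).2 ⟨i, rfl⟩⟩
      have := T.level_le h
      omega
  rw [this, Finset.card_image_of_injOn, Finset.card_range]
  exact (T.iter_inj z).mono (by intro i hi; simp at hi ⊢; omega)

lemma lcaLevel_eq_card (T : TreeOn V) (x y : V) :
    T.lcaLevel x y = ((Finset.univ.erase T.root).filter
      fun u => T.IsAncestor u x ∧ T.IsAncestor u y).card := by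
  obtain ⟨m, hm, hmax⟩ := Finset.exists_max_image
    (Finset.univ.filter fun u => T.IsAncestor u x ∧ T.IsAncestor u y) T.level
    ⟨T.root, by simp [anc_root]⟩
  simp only [Finset.mem_filter, Finset.mem_univ, true_and] at hm hmax
  have h1 : T.lcaLevel x y = T.level m := by
    apply le_antisymm
    · apply Finset.sup_le
      intro u hu
      exact hmax u (by simpa using hu)
    · exact Finset.le_sup (f := T.level) (by simpa using hm)
  rw [h1, level_eq_card]
  congr 1
  apply Finset.filter_congr
  intro u _
  constructor
  · intro h
    exact ⟨T.anc_trans h hm.1, T.anc_trans h hm.2⟩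
  · intro h
    rcases T.anc_total h.1 hm.1 with h2 | h2
    · exact h2
    · rw [T.anc_eq_of_level h2 (hmax u h)]; exact T.anc_refl _

/-- ancestor indicator -/
noncomputable def ind (T : TreeOn V) (u x : V) : ℝ := if T.IsAncestor u x then 1 else 0

/-- sum of `h` over leaf descendants of `u` -/
noncomputable def F (T : TreeOn V) (h : V → ℝ) (u : V) : ℝ :=
  ∑ x ∈ Finset.univ.filter T.IsLeaf, T.ind u x * h x

/-- quadratic form -/
noncomputable def Q (T : TreeOn V) (h : V → ℝ) : ℝ :=
  ∑ u ∈ Finset.univ.erase T.root, T.F h u ^ 2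

/-- squared norm -/
noncomputable def N (T : TreeOn V) (h : V → ℝ) : ℝ :=
  ∑ x ∈ Finset.univ.filter T.IsLeaf, h x ^ 2

lemma lca_eq_sum (T : TreeOn V) (x y : V) :
    (T.lcaLevel x y : ℝ) = ∑ u ∈ Finset.univ.erase T.root, T.ind u x * T.ind u y := by
  rw [lcaLevel_eq_card, Finset.card_filter]
  push_cast
  apply Finset.sum_congr rfl
  intro u _
  unfold ind
  by_cases h1 : T.IsAncestor u x <;> by_cases h2 : T.IsAncestor u y <;> simp [h1, h2]

lemma sum_leaf (T : TreeOn V) (g : V → ℝ) :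
    ∑ x : T.Leaf, g x.1 = ∑ x ∈ Finset.univ.filter T.IsLeaf, g x := by
  rw [Finset.sum_subtype (p := T.IsLeaf) (Finset.univ.filter T.IsLeaf) (by simp)]

lemma mulVec_eq (T : TreeOn V) (h : V → ℝ) (y : T.Leaf) :
    T.ancMatrix.mulVec (fun x => h x.1) y
      = ∑ u ∈ Finset.univ.erase T.root, T.ind u y.1 * T.F h u := by
  simp only [Matrix.mulVec, dotProduct, ancMatrix, Matrix.of_apply, lca_eq_sum, F]
  rw [T.sum_leaf (fun x => (∑ u ∈ Finset.univ.erase T.root, T.ind u y.1 * T.ind u x) * h x)]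
  simp only [Finset.sum_mul, Finset.mul_sum]
  rw [Finset.sum_comm]
  simp only [mul_assoc]

lemma sum_mul_mulVec (T : TreeOn V) (h : V → ℝ) :
    ∑ y ∈ Finset.univ.filter T.IsLeaf,
      h y * ∑ u ∈ Finset.univ.erase T.root, T.ind u y * T.F h u = T.Q h := by
  simp only [Finset.mul_sum, Q]
  rw [Finset.sum_comm]
  apply Finset.sum_congr rfl
  intro u _
  rw [show T.F h u ^ 2 = (∑ x ∈ Finset.univ.filter T.IsLeaf, T.ind u x * h x) * T.F h u
    from sq _, Finset.sum_mul]
  apply Finset.sum_congr rfl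
  intro x _
  ring

lemma dot_eq (T : TreeOn V) (h : V → ℝ) :
    (fun x : T.Leaf => h x.1) ⬝ᵥ T.ancMatrix.mulVec (fun x => h x.1) = T.Q h := by
  rw [← sum_mul_mulVec, ← sum_leaf]
  simp only [dotProduct, mulVec_eq]

lemma lca_comm (T : TreeOn V) (x y : V) : T.lcaLevel x y = T.lcaLevel y x := by
  simp only [lcaLevel, and_comm]

lemma bdd (T : TreeOn V) :
    BddAbove {μ : ℝ | ∃ x : T.Leaf → ℝ, x ≠ 0 ∧ T.ancMatrix.mulVec x = μ • x} := by
  have : {μ : ℝ | ∃ x : T.Leaf → ℝ, x ≠ 0 ∧ T.ancMatrix.mulVec x = μ • x}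
      ⊆ {μ | Module.End.HasEigenvalue (Matrix.toLin' T.ancMatrix) μ} := by
    rintro μ ⟨x, hx, h⟩
    exact Module.End.hasEigenvalue_of_hasEigenvector (x := x)
      ⟨Module.End.mem_eigenspace_iff.2 (by simpa using h), hx⟩
  exact ((Module.End.finite_hasEigenvalue _).subset this).bddAbove

lemma psd (T : TreeOn V) : (T.rhoC • (1 : Matrix T.Leaf T.Leaf ℝ) - T.ancMatrix).PosSemidef := by
  have hC : T.ancMatrix.IsHermitian := by
    ext i j
    simp [ancMatrix, T.lca_comm]
  have hH : (T.rhoC • (1 : Matrix T.Leaf T.Leaf ℝ) - T.ancMatrix).IsHermitian := by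
    apply Matrix.IsHermitian.sub _ hC
    ext i j
    simp [Matrix.one_apply, eq_comm]
  rw [hH.posSemidef_iff_eigenvalues_nonneg]
  intro i
  have h := hH.mulVec_eigenvectorBasis i
  set x : T.Leaf → ℝ := ⇑(hH.eigenvectorBasis i) with hx
  have hx0 : x ≠ 0 := by
    intro h0
    apply hH.eigenvectorBasis.toBasis.ne_zero i
    ext j
    have := congrFun h0 j
    simpa using this
  rw [Matrix.sub_mulVec, Matrix.smul_mulVec, Matrix.one_mulVec] at h
  have h2 : T.ancMatrix.mulVec x = (T.rhoC - hH.eigenvalues i) • x := by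
    rw [sub_smul, ← h]; simp
  have := le_csSup T.bdd ⟨x, hx0, h2⟩
  change _ ≤ T.rhoC at this
  simp; linarith

lemma dot_psd (T : TreeOn V) (h : V → ℝ) :
    (fun x : T.Leaf => h x.1) ⬝ᵥ
      (T.rhoC • (1 : Matrix T.Leaf T.Leaf ℝ) - T.ancMatrix).mulVec (fun x => h x.1)
      = T.rhoC * T.N h - T.Q h := by
  rw [Matrix.sub_mulVec, Matrix.smul_mulVec, Matrix.one_mulVec, dotProduct_sub, dot_eq,
    dotProduct_smul, N, ← sum_leaf]
  simp [dotProduct, sq]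

lemma rayleigh (T : TreeOn V) (h : V → ℝ) : T.Q h ≤ T.rhoC * T.N h := by
  have := T.psd.dotProduct_mulVec_nonneg (fun x => h x.1)
  have h2 := T.dot_psd h
  simp only [star_trivial] at this
  linarith

lemma rayleigh_eq (T : TreeOn V) (h : V → ℝ) (he : T.Q h = T.rhoC * T.N h) (y : V)
    (hy : T.IsLeaf y) :
    ∑ u ∈ Finset.univ.erase T.root, T.ind u y * T.F h u = T.rhoC * h y := by
  have h1 := (T.psd.dotProduct_mulVec_zero_iff (fun x => h x.1)).1
    (by rw [star_trivial, dot_psd]; linarith)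
  have h2 := congrFun h1 ⟨y, hy⟩
  rw [Matrix.sub_mulVec, Matrix.smul_mulVec, Matrix.one_mulVec, Pi.sub_apply, mulVec_eq] at h2
  simp only [Pi.smul_apply, smul_eq_mul, Pi.zero_apply] at h2
  linarith

lemma exists_leaf (T : TreeOn V) (w : V) :
    ∃ x, T.IsLeaf x ∧ T.IsAncestor w x := by
  obtain ⟨m, hm, hmax⟩ := Finset.exists_max_image
    (Finset.univ.filter fun u => T.IsAncestor w u) T.level ⟨w, by simp [anc_refl]⟩
  simp only [Finset.mem_filter, Finset.mem_univ, true_and] at hm hmax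
  refine ⟨m, fun u hu => ?_, hm⟩
  have h1 : T.IsAncestor m u := (T.anc_step _ _).2 (Or.inr (hu ▸ T.anc_refl _))
  exact (T.anc_eq_of_level h1 (hmax u (T.anc_trans hm h1))).symm

lemma F_add_smul (T : TreeOn V) (f g : V → ℝ) (c : ℝ) (u : V) :
    T.F (fun x => f x + c * g x) u = T.F f u + c * T.F g u := by
  simp only [F, Finset.mul_sum, ← Finset.sum_add_distrib]
  apply Finset.sum_congr rfl
  intro x _; ring

end TreeOn

namespace TreeOn

variable {V : Type} [Fintype V] [DecidableEq V]

lemma leaf_anc (T : TreeOn V) {w z : V} (hw : T.IsLeaf w) (h : T.IsAncestor w z) : z = w := by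
  obtain ⟨n, hn⟩ := (T.anc_iff _ _).1 h
  induction n generalizing z with
  | zero => simpa using hn
  | succ n ih =>
    exact hw z (ih ((T.anc_iff _ _).2 ⟨n, hn⟩) hn)

/-- the data of a leaf swap -/
structure Swap (T T' : TreeOn V) (a b w1 w2 : V) : Prop where
  hab : T.IsAncestor a b
  hw1 : T.parent w1 = a
  hw1r : w1 ≠ T.root
  hw1b : ¬ T.IsAncestor w1 b
  hw1l : ¬ T.IsLeaf w1
  hw2 : T.parent w2 = b
  hw2l : T.IsLeaf w2
  hw2b : b ≠ w2
  hroot : T'.root = T.root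
  hpar1 : T'.parent w1 = b
  hpar2 : T'.parent w2 = a
  hpar : ∀ x, x ≠ w1 → x ≠ w2 → T'.parent x = T.parent x

namespace Swap

variable {T T' : TreeOn V} {a b w1 w2 : V}

lemma hw2r (H : Swap T T' a b w1 w2) : w2 ≠ T.root := by
  intro h
  apply H.hw2b
  rw [← H.hw2, h, T.parent_root]

lemma hne (H : Swap T T' a b w1 w2) : w1 ≠ w2 := fun h => H.hw1l (h ▸ H.hw2l)

lemma w1a (H : Swap T T' a b w1 w2) : ¬ T.IsAncestor w1 a :=
  fun h => H.hw1b (T.anc_trans h H.hab)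

lemma w2b (H : Swap T T' a b w1 w2) : ¬ T.IsAncestor w2 b :=
  fun h => H.hw2b (T.leaf_anc H.hw2l h)

lemma w2a (H : Swap T T' a b w1 w2) : ¬ T.IsAncestor w2 a :=
  fun h => H.w2b (T.anc_trans h H.hab)

lemma w1w2 (H : Swap T T' a b w1 w2) : ¬ T.IsAncestor w1 w2 := by
  rw [anc_step, H.hw2]
  rintro (h | h)
  · exact H.hne h
  · exact H.hw1b h

lemma anc_out (H : Swap T T' a b w1 w2) (u x : V) :
    ¬ T.IsAncestor w1 x → x ≠ w2 → (T'.IsAncestor u x ↔ T.IsAncestor u x) := by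
  induction x using T.parent_induction with
  | h0 =>
    intro _ _
    rw [anc_root_iff, ← H.hroot, anc_root_iff]
  | hs x hx ih =>
    intro h1 h2
    rw [anc_step] at h1
    push Not at h1
    have h3 : T.parent x ≠ w2 := fun h => h2 (H.hw2l x h)
    rw [T'.anc_step, T.anc_step, H.hpar x (Ne.symm h1.1) h2, ih h1.2 h3]

lemma anc_w2 (H : Swap T T' a b w1 w2) (u : V) :
    T'.IsAncestor u w2 ↔ u = w2 ∨ T.IsAncestor u a := by
  rw [T'.anc_step, H.hpar2, H.anc_out u a H.w1a (fun h => H.w2a (h ▸ T.anc_refl _))]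

lemma anc_w2' (H : Swap T T' a b w1 w2) (u : V) :
    T.IsAncestor u w2 ↔ u = w2 ∨ T.IsAncestor u b := by
  rw [T.anc_step, H.hw2]

lemma anc_in (H : Swap T T' a b w1 w2) (u x : V) :
    T.IsAncestor w1 x →
      (T'.IsAncestor u x ↔ (T.IsAncestor u x ∧ T.IsAncestor w1 u) ∨ T.IsAncestor u b) := by
  induction x using T.parent_induction with
  | h0 =>
    intro h
    exact absurd ((T.anc_root_iff _).1 h) H.hw1r
  | hs x hx ih =>
    intro h
    by_cases hx1 : x = w1
    · subst hx1
      rw [T'.anc_step, H.hpar1, H.anc_out u b H.hw1b H.hw2b]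
      constructor
      · rintro (rfl | h)
        · exact Or.inl ⟨T.anc_refl _, T.anc_refl _⟩
        · exact Or.inr h
      · rintro (h | h)
        · exact Or.inl (T.anc_antisymm h.1 h.2)
        · exact Or.inr h
    · have hx2 : x ≠ w2 := fun h' => H.w1w2 (h' ▸ h)
      have h' := (T.anc_step _ _).1 h
      have hp := h'.resolve_left (Ne.symm hx1)
      rw [T'.anc_step, H.hpar x hx1 hx2, ih hp, T.anc_step u x]
      constructor
      · rintro (rfl | h | h)
        · exact Or.inl ⟨Or.inl rfl, h⟩
        · exact Or.inl ⟨Or.inr h.1, h.2⟩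
        · exact Or.inr h
      · rintro (⟨rfl | h1, h2⟩ | h)
        · exact Or.inl rfl
        · exact Or.inr (Or.inl ⟨h1, h2⟩)
        · exact Or.inr (Or.inr h)

lemma anc_in' (H : Swap T T' a b w1 w2) (u x : V) (h : T.IsAncestor w1 x)
    (hu : ¬ T.IsAncestor w1 u) : T.IsAncestor u x ↔ T.IsAncestor u a := by
  have h1 : T.IsAncestor a w1 := by rw [anc_step, H.hw1]; exact Or.inr (T.anc_refl _)
  constructor
  · intro h2
    have h3 := (T.anc_total h2 h).resolve_right hu
    rw [anc_step, H.hw1] at h3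
    rcases h3 with rfl | h3
    · exact absurd (T.anc_refl _) hu
    · exact h3
  · intro h2
    exact T.anc_trans h2 (T.anc_trans h1 h)

lemma ind_eq (H : Swap T T' a b w1 w2) (u x : V) :
    T'.ind u x = T.ind u x + (T.ind u b - T.ind u a) *
      (T.ind w1 x - if x = w2 then 1 else 0) := by
  unfold ind
  by_cases hx : T.IsAncestor w1 x
  · have hx2 : x ≠ w2 := fun h' => H.w1w2 (h' ▸ hx)
    by_cases hu : T.IsAncestor w1 u
    · have h1 : ¬ T.IsAncestor u b := fun h => H.hw1b (T.anc_trans hu h)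
      have h2 : ¬ T.IsAncestor u a := fun h => H.w1a (T.anc_trans hu h)
      simp [H.anc_in u x hx, hx, hu, h1, h2]
    · simp [H.anc_in u x hx, hx, hu, hx2, H.anc_in' u x hx hu]
  · by_cases hx2 : x = w2
    · subst hx2
      simp only [H.anc_w2, H.anc_w2']
      by_cases hu : u = x
      · subst hu; simp [H.w2a, H.w2b]
      · simp [hu, H.hne, H.hw1b]
    · simp [hx, hx2, H.anc_out u x hx hx2]

lemma leaf_iff (H : Swap T T' a b w1 w2) (x : V) : T'.IsLeaf x ↔ T.IsLeaf x := by
  have hb1 : w1 ≠ b := fun h => H.hw1b (h ▸ T.anc_refl _)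
  have ha1 : w1 ≠ a := fun h => H.w1a (h ▸ T.anc_refl _)
  have ha2 : w2 ≠ a := fun h => H.w2a (h ▸ T.anc_refl _)
  constructor
  · intro h u hu
    by_cases h1 : u = w1
    · subst h1
      rw [H.hw1] at hu
      exact absurd (h w2 (H.hpar2.trans hu)) (fun h => ha2 (h.trans hu.symm))
    · by_cases h2 : u = w2
      · subst h2
        rw [H.hw2] at hu
        exact absurd (h w1 (H.hpar1.trans hu)) (fun h => hb1 (h.trans hu.symm))
      · exact h u (by rw [H.hpar u h1 h2, hu])
  · intro h u hu
    by_cases h1 : u = w1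
    · subst h1
      rw [H.hpar1] at hu
      exact absurd (h w2 (H.hw2.trans hu)) (fun h => H.hw2b (hu.trans h.symm))
    · by_cases h2 : u = w2
      · subst h2
        rw [H.hpar2] at hu
        exact absurd (h w1 (H.hw1.trans hu)) (fun h => ha1 (h.trans hu.symm))
      · exact h u (by rw [← H.hpar u h1 h2, hu])

lemma filter_eq (H : Swap T T' a b w1 w2) :
    Finset.univ.filter T'.IsLeaf = Finset.univ.filter T.IsLeaf :=
  Finset.filter_congr (fun x _ => H.leaf_iff x)

lemma F_eq (H : Swap T T' a b w1 w2) (h : V → ℝ) (u : V) :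
    T'.F h u = T.F h u + (T.ind u b - T.ind u a) * (T.F h w1 - h w2) := by
  have hw : w2 ∈ Finset.univ.filter T.IsLeaf := by simpa using H.hw2l
  have e : h w2 = ∑ x ∈ Finset.univ.filter T.IsLeaf, (if x = w2 then 1 else 0) * h x := by
    simp [Finset.sum_ite_eq', H.hw2l]
  rw [e]
  unfold F
  rw [H.filter_eq, ← Finset.sum_sub_distrib, Finset.mul_sum, ← Finset.sum_add_distrib]
  apply Finset.sum_congr rfl
  intro x _
  rw [H.ind_eq]; ring

end Swap

end TreeOn

namespace TreeOn

variable {V : Type} [Fintype V] [DecidableEq V]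

lemma ind_nonneg (T : TreeOn V) (u x : V) : 0 ≤ T.ind u x := by
  unfold ind; split_ifs <;> norm_num

lemma F_nonneg (T : TreeOn V) {h : V → ℝ} (hh : ∀ x, 0 ≤ h x) (u : V) : 0 ≤ T.F h u :=
  Finset.sum_nonneg fun x _ => mul_nonneg (T.ind_nonneg u x) (hh x)

lemma le_F (T : TreeOn V) {h : V → ℝ} (hh : ∀ x, 0 ≤ h x) {u x : V} (hx : T.IsLeaf x)
    (hu : T.IsAncestor u x) : h x ≤ T.F h u := by
  have := Finset.single_le_sum (f := fun x => T.ind u x * h x)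
    (s := Finset.univ.filter T.IsLeaf)
    (fun x _ => mul_nonneg (T.ind_nonneg u x) (hh x)) (a := x) (by simpa using hx)
  simpa [ind, F, hu] using this

lemma N_nonneg (T : TreeOn V) (h : V → ℝ) : 0 ≤ T.N h :=
  Finset.sum_nonneg fun x _ => sq_nonneg _

lemma Q_nonneg (T : TreeOn V) (h : V → ℝ) : 0 ≤ T.Q h :=
  Finset.sum_nonneg fun x _ => sq_nonneg _

lemma N_pos (T : TreeOn V) {h : V → ℝ} {x : V} (hx : T.IsLeaf x) (hp : 0 < h x) : 0 < T.N h := by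
  have := Finset.single_le_sum (f := fun x => h x ^ 2)
    (s := Finset.univ.filter T.IsLeaf)
    (fun x _ => sq_nonneg _) (a := x) (by simpa using hx)
  have h2 : 0 < h x ^ 2 := by positivity
  exact h2.trans_le this

lemma F_delta (T : TreeOn V) {x : V} (hx : T.IsLeaf x) (u : V) :
    T.F (fun y => if y = x then 1 else 0) u = T.ind u x := by
  simp [F, hx]

lemma N_delta (T : TreeOn V) {x : V} (hx : T.IsLeaf x) :
    T.N (fun y => if y = x then 1 else 0) = 1 := by
  simp [N, hx]

namespace Swap

variable {T T' : TreeOn V} {a b w1 w2 : V}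

lemma N_eq (H : Swap T T' a b w1 w2) (h : V → ℝ) : T'.N h = T.N h := by
  unfold N; rw [H.filter_eq]

lemma ind_w2 (H : Swap T T' a b w1 w2) (u : V) :
    T.ind u w2 = (if u = w2 then 1 else 0) + T.ind u b := by
  unfold ind
  simp only [H.anc_w2']
  by_cases hu : u = w2
  · subst hu; simp [H.w2b]
  · simp [hu]

lemma w1_not_leaf_desc (H : Swap T T' a b w1 w2) {x : V} (hx : T.IsLeaf x) : x ≠ w1 :=
  fun h => H.hw1l (h ▸ hx)

/-- degenerate case -/
lemma degenerate (H : Swap T T' a b w1 w2) (hb : b = T.root) (f : V → ℝ)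
    (ht : 0 < f w2)
    (he : ∀ y, T.IsLeaf y →
      ∑ u ∈ Finset.univ.erase T.root, T.ind u y * T.F f u = T.rhoC * f y) : False := by
  have h1 := he w2 H.hw2l
  have h2 : ∑ u ∈ Finset.univ.erase T.root, T.ind u w2 * T.F f u = T.F f w2 := by
    rw [Finset.sum_eq_single w2]
    · simp [ind, T.anc_refl]
    · intro u hu hne
      rw [H.ind_w2, hb]
      simp at hu
      simp [ind, T.anc_root_iff, hu, hne]
    · intro h; exact absurd H.hw2r (by simpa using h)
  have h3 : T.F f w2 = f w2 := by
    unfold F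
    rw [Finset.sum_eq_single w2]
    · simp [ind, T.anc_refl]
    · intro x _ hne
      have : ¬ T.IsAncestor w2 x := fun h => hne (T.leaf_anc H.hw2l h)
      simp [ind, this]
    · intro h; exact absurd H.hw2l (by simpa using h)
  have hrho : T.rhoC = 1 := by
    rw [h2, h3] at h1
    have : (T.rhoC - 1) * f w2 = 0 := by linarith
    rcases mul_eq_zero.1 this with h | h <;> linarith
  obtain ⟨x, hx, hwx⟩ := T.exists_leaf w1
  have hr := T.rayleigh (fun y => if y = x then 1 else 0)
  rw [T.N_delta hx, hrho] at hr
  have hxr : x ≠ T.root := by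
    rintro rfl
    exact H.hw1r ((T.anc_root_iff _).1 hwx)
  have hsub : ({w1, x} : Finset V) ⊆ Finset.univ.erase T.root := by
    intro z hz
    simp at hz
    rcases hz with rfl | rfl
    · simpa using H.hw1r
    · simpa using hxr
  have := Finset.sum_le_sum_of_subset_of_nonneg (f := fun u => T.ind u x ^ 2) hsub
    (fun _ _ _ => sq_nonneg _)
  rw [Finset.sum_pair (H.w1_not_leaf_desc hx).symm] at this
  simp only [Q, T.F_delta hx] at hr
  simp only [ind, hwx, T.anc_refl, if_true] at this hr
  linarith

lemma pi_nonneg (H : Swap T T' a b w1 w2) (u : V) : 0 ≤ T.ind u b - T.ind u a := by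
  unfold ind
  by_cases h : T.IsAncestor u a
  · simp [h, T.anc_trans h H.hab]
  · simp only [h, if_false]; split_ifs <;> norm_num

lemma case_ge (H : Swap T T' a b w1 w2) (hab : a ≠ b) (f : V → ℝ)
    (hf : ∀ x, 0 ≤ f x) (ht : 0 < f w2)
    (he : ∀ y, T.IsLeaf y →
      ∑ u ∈ Finset.univ.erase T.root, T.ind u y * T.F f u = T.rhoC * f y)
    (hQ : T.Q f = T.rhoC * T.N f) (hS : f w2 ≤ T.F f w1) : T.rhoC < T'.rhoC := by
  by_contra hle
  push Not at hle
  have hN := T.N_pos H.hw2l ht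
  have h1 : T.Q f ≤ T'.Q f := by
    unfold Q
    rw [H.hroot]
    apply Finset.sum_le_sum
    intro u _
    rw [H.F_eq]
    have h2 := mul_nonneg (H.pi_nonneg u) (sub_nonneg.2 hS)
    have h3 := T.F_nonneg hf u
    gcongr
    linarith
  have h2 := T'.rayleigh f
  rw [H.N_eq] at h2
  have h3 : T'.rhoC = T.rhoC := by
    apply le_antisymm hle
    exact le_of_mul_le_mul_right (by linarith) hN
  have h4 := T'.rayleigh_eq f (by rw [H.N_eq, h3]; rw [h3] at h2; linarith) w2
    ((H.leaf_iff _).2 H.hw2l)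
  have h5 := he w2 H.hw2l
  rw [h3, ← h5, H.hroot] at h4
  have h6 : ∀ u, T'.ind u w2 * T'.F f u
      = T.ind u w2 * T.F f u - (T.ind u b - T.ind u a) * T.F f u := by
    intro u
    rw [H.ind_eq, H.F_eq, H.ind_w2]
    have e : T.ind w1 w2 = 0 := by simp [ind, H.w1w2]
    rw [e]
    have hz : ((if u = w2 then 1 else 0) + T.ind u a) * (T.ind u b - T.ind u a) = 0 := by
      by_cases hu : u = w2
      · subst hu; simp [ind, H.w2a, H.w2b]
      · by_cases h : T.IsAncestor u a
        · simp [ind, h, T.anc_trans h H.hab]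
        · simp [ind, h, hu]
    simp only [if_true]
    linear_combination (T.F f w1 - f w2) * hz
  simp only [h6, Finset.sum_sub_distrib] at h4
  have hba : ¬ T.IsAncestor b a := fun h => hab (T.anc_antisymm H.hab h)
  have hbr : b ≠ T.root := fun h => hba (h ▸ T.anc_root a)
  have h7 := Finset.single_le_sum (f := fun u => (T.ind u b - T.ind u a) * T.F f u)
    (s := Finset.univ.erase T.root)
    (fun u _ => mul_nonneg (H.pi_nonneg u) (T.F_nonneg hf u)) (a := b) (by simpa using hbr)
  have h8 := T.le_F hf H.hw2l ((H.anc_w2' b).2 (Or.inr (T.anc_refl b)))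
  have e1 : T.ind b b = 1 := by simp [ind, T.anc_refl]
  have e2 : T.ind b a = 0 := by simp [ind, hba]
  simp only [e1, e2] at h7
  simp only [← Finset.sum_sub_distrib] at h4
  simp only [Finset.sum_sub_distrib] at h4
  linarith

lemma case_lt (H : Swap T T' a b w1 w2) (f : V → ℝ)
    (ht : 0 < f w2) (hQ : T.Q f = T.rhoC * T.N f) (S t : ℝ) (hS : S = T.F f w1)
    (htd : t = f w2) (hS0 : 0 ≤ S) (hSt : S < t)
    (p : V → ℝ) (hp : ∀ x, 0 ≤ p x) (hp0 : ∀ x, ¬ T.IsAncestor w1 x → p x = 0)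
    (hp1 : T.F p w1 = 1) (hpf : ∀ x, T.IsLeaf x → T.IsAncestor w1 x → f x = S * p x) :
    T.rhoC < T'.rhoC := by
  by_contra hle
  push Not at hle
  have hN := T.N_pos H.hw2l ht
  have hrho : 0 ≤ T.rhoC := by
    by_contra hneg
    push Not at hneg
    have := T.Q_nonneg f
    nlinarith
  have hfac : 0 < t ^ 2 - S ^ 2 := by nlinarith
  have hpw2 : p w2 = 0 := hp0 _ H.w1w2
  set d : V → ℝ := fun x => (if x = w2 then 1 else 0) + (-1) * p x with hd
  set g : V → ℝ := fun x => f x + (S - t) * d x with hg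
  have hsum : ∑ x ∈ Finset.univ.filter T.IsLeaf, p x = 1 := by
    rw [← hp1]
    unfold F
    apply Finset.sum_congr rfl
    intro x _
    by_cases h : T.IsAncestor w1 x
    · simp [ind, h]
    · simp [hp0 x h]
  have hle1 : ∀ x, T.IsLeaf x → p x ≤ 1 := by
    intro x hx
    rw [← hsum]
    exact Finset.single_le_sum (fun x _ => hp x) (by simpa using hx)
  have hNp : T.N p ≤ 1 := by
    rw [← hsum]
    apply Finset.sum_le_sum
    intro x hx
    have := hle1 x (by simpa using hx)
    nlinarith [hp x]
  -- norm
  have hNg : T.N g ≤ T.N f := by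
    have e : T.N g = T.N f + (S ^ 2 - t ^ 2) * (1 - T.N p) := by
      rw [← T.N_delta H.hw2l]
      unfold N
      rw [← Finset.sum_sub_distrib, Finset.mul_sum, ← Finset.sum_add_distrib]
      apply Finset.sum_congr rfl
      intro x hx
      have hx : T.IsLeaf x := by simpa using hx
      by_cases h2 : x = w2
      · subst h2
        simp only [hg, hd, if_true, hpw2, htd]; ring
      · by_cases h1 : T.IsAncestor w1 x
        · simp only [hg, hd, if_neg h2, hpf x hx h1]; ring
        · simp only [hg, hd, if_neg h2, hp0 x h1]; ring
    rw [e]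
    nlinarith
  have hFd : ∀ u, T.F d u = T.ind u w2 - T.F p u := by
    intro u
    rw [hd, T.F_add_smul, T.F_delta H.hw2l]; ring
  have hFg : ∀ u, T.F g u = T.F f u + (S - t) * (T.ind u w2 - T.F p u) := by
    intro u
    rw [hg, T.F_add_smul, hFd]
  have hgw2 : g w2 = S := by
    simp only [hg, hd, if_true, hpw2, htd]; ring
  have e0 : T.ind w1 w2 = 0 := by simp [ind, H.w1w2]
  have hFgw1 : T.F g w1 = t := by
    rw [hFg, hp1, e0, hS]; ring
  have hsq : ∀ u, T'.F g u ^ 2 = T.F f u ^ 2 + (S ^ 2 - t ^ 2) * (if u = w2 then 1 else 0)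
      + (t ^ 2 - S ^ 2) * (T.ind w1 u * T.F p u ^ 2) := by
    intro u
    rw [H.F_eq, hgw2, hFgw1, hFg, H.ind_w2]
    by_cases h1 : T.IsAncestor w1 u
    · have hb : T.ind u b = 0 := by
        simp [ind, show ¬ T.IsAncestor u b from fun h => H.hw1b (T.anc_trans h1 h)]
      have ha : T.ind u a = 0 := by
        simp [ind, show ¬ T.IsAncestor u a from fun h => H.w1a (T.anc_trans h1 h)]
      have h2 : u ≠ w2 := fun h => H.w1w2 (h ▸ h1)
      have e1 : T.ind w1 u = 1 := by simp [ind, h1]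
      have e2 : T.F f u = S * T.F p u := by
        unfold F
        rw [Finset.mul_sum]
        apply Finset.sum_congr rfl
        intro x hx
        by_cases hux : T.IsAncestor u x
        · rw [hpf x (by simpa using hx) (T.anc_trans h1 hux)]; ring
        · simp [ind, hux]
      rw [hb, ha, e1, e2, if_neg h2]; ring
    · have e1 : T.ind w1 u = 0 := by simp [ind, h1]
      have e2 : T.F p u = T.ind u a := by
        have : T.F p u = T.ind u a * ∑ x ∈ Finset.univ.filter T.IsLeaf, p x := by
          unfold F
          rw [Finset.mul_sum]
          apply Finset.sum_congr rfl
          intro x _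
          by_cases hx : T.IsAncestor w1 x
          · simp only [ind, H.anc_in' u x hx h1]
          · rw [hp0 x hx]; ring
        rw [this, hsum, mul_one]
      rw [e1, e2]
      by_cases h2 : u = w2
      · subst h2
        have e3 : T.F f u = t := by
          rw [htd]
          unfold F
          rw [Finset.sum_eq_single u]
          · simp [ind, T.anc_refl]
          · intro x _ hne
            have : ¬ T.IsAncestor u x := fun h => hne (T.leaf_anc H.hw2l h)
            simp [ind, this]
          · intro h; exact absurd H.hw2l (by simpa using h)
        have hb : T.ind u b = 0 := by simp [ind, H.w2b]
        have ha : T.ind u a = 0 := by simp [ind, H.w2a]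
        rw [e3, hb, ha]; simp
      · rw [if_neg h2]; ring
  have hQ' : T'.Q g = T.Q f + (t ^ 2 - S ^ 2) *
      ((∑ u ∈ Finset.univ.erase T.root, T.ind w1 u * T.F p u ^ 2) - 1) := by
    have e1 : ∑ u ∈ Finset.univ.erase T.root, (if u = w2 then (1 : ℝ) else 0) = 1 := by
      rw [Finset.sum_ite_eq', if_pos (by simpa using H.hw2r)]
    unfold Q
    rw [H.hroot]
    simp only [hsq, Finset.sum_add_distrib, ← Finset.mul_sum, e1]
    ring
  obtain ⟨x, hx, hpx⟩ : ∃ x ∈ Finset.univ.filter T.IsLeaf, 0 < p x := by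
    by_contra hno
    push Not at hno
    have := Finset.sum_nonpos hno
    linarith
  have hx : T.IsLeaf x := by simpa using hx
  have hwx : T.IsAncestor w1 x := by
    by_contra h
    rw [hp0 x h] at hpx
    exact lt_irrefl _ hpx
  have hxr : x ≠ T.root := by
    rintro rfl
    exact H.hw1r ((T.anc_root_iff _).1 hwx)
  have hsub : ({w1, x} : Finset V) ⊆ Finset.univ.erase T.root := by
    intro z hz
    simp at hz
    rcases hz with rfl | rfl
    · simpa using H.hw1r
    · simpa using hxr
  have hbig := Finset.sum_le_sum_of_subset_of_nonneg
    (f := fun u => T.ind w1 u * T.F p u ^ 2) hsub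
    (fun _ _ _ => mul_nonneg (T.ind_nonneg _ _) (sq_nonneg _))
  rw [Finset.sum_pair (H.w1_not_leaf_desc hx).symm, hp1] at hbig
  have e3 : T.ind w1 w1 = 1 := by simp [ind, T.anc_refl]
  have e4 : T.ind w1 x = 1 := by simp [ind, hwx]
  have h8 := T.le_F hp hx (T.anc_refl x)
  have h9 : 0 < T.F p x ^ 2 := pow_pos (hpx.trans_le h8) 2
  rw [e3, e4] at hbig
  have h10 : T.Q f < T'.Q g := by
    rw [hQ']
    have := mul_pos hfac (show 0 < (∑ u ∈ Finset.univ.erase T.root,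
      T.ind w1 u * T.F p u ^ 2) - 1 by linarith)
    linarith
  have h11 := T'.rayleigh g
  rw [H.N_eq] at h11
  have h12 := mul_le_mul_of_nonneg_right hle (T.N_nonneg g)
  have h13 := mul_le_mul_of_nonneg_left hNg hrho
  linarith

lemma main (H : Swap T T' a b w1 w2) (hab : a = b → b = T.root) (f : V → ℝ)
    (hf : ∀ x, 0 ≤ f x) (ht : 0 < f w2)
    (he : ∀ y, T.IsLeaf y →
      ∑ u ∈ Finset.univ.erase T.root, T.ind u y * T.F f u = T.rhoC * f y) :
    T.rhoC < T'.rhoC := by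
  by_cases h : a = b
  · exact (H.degenerate (hab h) f ht he).elim
  have hQ : T.Q f = T.rhoC * T.N f := by
    rw [← T.sum_mul_mulVec, N, Finset.mul_sum]
    apply Finset.sum_congr rfl
    intro y hy
    rw [he y (by simpa using hy)]; ring
  rcases le_or_gt (f w2) (T.F f w1) with hS | hS
  · exact H.case_ge h f hf ht he hQ hS
  rcases (T.F_nonneg hf w1).eq_or_lt with h0 | h0
  · obtain ⟨x0, hx0, hwx0⟩ := T.exists_leaf w1
    refine H.case_lt f ht hQ _ _ rfl rfl h0.le hS (fun y => if y = x0 then 1 else 0) ?_ ?_ ?_ ?_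
    · intro x; split_ifs <;> norm_num
    · intro x hx
      rw [if_neg]
      rintro rfl
      exact hx hwx0
    · rw [T.F_delta hx0]; simp [ind, hwx0]
    · intro x hx hwx
      have := T.le_F hf hx hwx
      have := hf x
      rw [← h0, zero_mul]; linarith
  · refine H.case_lt f ht hQ _ _ rfl rfl h0.le hS
      (fun y => T.ind w1 y * f y / T.F f w1) ?_ ?_ ?_ ?_
    · intro x
      exact div_nonneg (mul_nonneg (T.ind_nonneg _ _) (hf x)) h0.le
    · intro x hx
      simp [ind, hx]
    · have : T.F (fun y => T.ind w1 y * f y / T.F f w1) w1 = T.F f w1 / T.F f w1 := by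
        conv_lhs => rw [F]
        conv_rhs => arg 1; rw [F]
        rw [Finset.sum_div]
        apply Finset.sum_congr rfl
        intro x _
        unfold ind
        split_ifs <;> ring
      rw [this, div_self h0.ne']
    · intro x hx hwx
      have : T.ind w1 x = 1 := by simp [ind, hwx]
      simp only [this]
      field_simp

end Swap

end TreeOn


/-- **leaf swap operation.** Let `v 0, v 1, …, v (k−1)`
(`k ≥ 2`) be consecutive vertices on a path from the root to a leaf of a
rooted tree `T` (so `v (i+1)` is a child of `v i`), with `v (k−1)` not a leaf.
Let `w1` be a non-leaf child of `v 0` different from `v 1` (the root of the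
subtree `B`), and let `w2` be a leaf child of `v (k−1)`.  The tree `T′` is
obtained from `T` by swapping `B` and the leaf `w2`: the edges `v 0 – w1` and
`v (k−1) – w2` are replaced by `v 0 – w2` and `v (k−1) – w1`.  If there is a
nonnegative eigenvector of `C(T)` for the eigenvalue `ρ_C(T)` whose entries at
all leaf descendants of `v (k−1)` are positive, then `ρ_C(T′) > ρ_C(T)`. -/
theorem rhoC_lt_rhoC_leafSwap
    {V : Type} [Fintype V] [DecidableEq V] (T T' : TreeOn V)
    (k : ℕ) (hk : 2 ≤ k) (v : ℕ → V)
    (hchain : ∀ i, i + 1 < k → T.parent (v (i + 1)) = v i)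
    (hnotleaf : ¬ T.IsLeaf (v (k - 1)))
    (w1 w2 : V)
    (hw1 : T.parent w1 = v 0) (hw1v : w1 ≠ v 1) (hw1nl : ¬ T.IsLeaf w1)
    (hw2 : T.parent w2 = v (k - 1)) (hw2l : T.IsLeaf w2)
    (hroot' : T'.root = T.root)
    (hpar' : T'.parent =
      Function.update (Function.update T.parent w1 (v (k - 1))) w2 (v 0))
    (f : T.Leaf → ℝ) (hf0 : f ≠ 0) (hfnn : ∀ u, 0 ≤ f u)
    (hfeig : T.ancMatrix.mulVec f = T.rhoC • f)
    (hfpos : ∀ u : T.Leaf, T.IsAncestor (v (k - 1)) u.1 → 0 < f u) :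
    T.rhoC < T'.rhoC := by
  have hw12 : w1 ≠ w2 := fun h => hw1nl (h ▸ hw2l)
  have hp2 : T'.parent w2 = v 0 := by rw [hpar']; simp
  have hp1 : T'.parent w1 = v (k - 1) := by rw [hpar']; simp [hw12]
  have hp : ∀ x, x ≠ w1 → x ≠ w2 → T'.parent x = T.parent x := by
    intro x h1 h2; rw [hpar']; simp [h1, h2]
  have hiter : ∀ n, n + 1 ≤ k → T.parent^[n] (v (k - 1)) = v (k - 1 - n) := by
    intro n
    induction n with
    | zero => intro _; rfl
    | succ n ih =>
      intro hn
      rw [Function.iterate_succ_apply', ih (by omega)]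
      have := hchain (k - 1 - (n + 1)) (by omega)
      rw [← this]
      congr 2
      omega
  have h0 : T.parent^[k - 1] (v (k - 1)) = v 0 := by
    rw [hiter (k - 1) (by omega)]; congr 1; omega
  have h1 : T.parent^[k - 2] (v (k - 1)) = v 1 := by
    rw [hiter (k - 2) (by omega)]; congr 1; omega
  have hw1r : w1 ≠ T.root := by
    intro h
    have hb : v (k - 1) = T.root := by
      rw [← hp1, h, ← hroot', T'.parent_root]
    rw [hb, T.iter_root] at h1
    exact hw1v (h.trans h1)
  have hbw2 : v (k - 1) ≠ w2 := fun h => hnotleaf (h ▸ hw2l)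
  have hw1b : ¬ T.IsAncestor w1 (v (k - 1)) := by
    intro h
    have hinv : ∀ n, T.IsAncestor w1 (T'.parent^[n] (v (k - 1))) ∧
        T.IsAncestor (T'.parent^[n] (v (k - 1))) (v (k - 1)) := by
      intro n
      induction n with
      | zero => exact ⟨h, T.anc_refl _⟩
      | succ n ih =>
        rw [Function.iterate_succ_apply']
        set x := T'.parent^[n] (v (k - 1))
        by_cases hx : x = w1
        · rw [hx, hp1]; exact ⟨h, T.anc_refl _⟩
        · have hx2 : x ≠ w2 := by
            intro hx2
            rw [hx2] at ih
            exact hbw2 (T.leaf_anc hw2l ih.2)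
          rw [hp x hx hx2]
          refine ⟨((T.anc_step _ _).1 ih.1).resolve_left (Ne.symm hx), T.anc_trans ?_ ih.2⟩
          exact (T.anc_step _ _).2 (Or.inr (T.anc_refl _))
    obtain ⟨n, hn⟩ := T'.reaches (v (k - 1))
    have := (hinv n).1
    rw [hn, hroot', T.anc_root_iff] at this
    exact hw1r this
  have H : TreeOn.Swap T T' (v 0) (v (k - 1)) w1 w2 :=
    { hab := (T.anc_iff _ _).2 ⟨_, h0⟩
      hw1 := hw1
      hw1r := hw1r
      hw1b := hw1b
      hw1l := hw1nl
      hw2 := hw2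
      hw2l := hw2l
      hw2b := hbw2
      hroot := hroot'
      hpar1 := hp1
      hpar2 := hp2
      hpar := hp }
  have hfe : (fun x : T.Leaf => (fun z => if h : T.IsLeaf z then f ⟨z, h⟩ else 0) x.1) = f := by
    funext x
    simp [x.2]
  refine H.main ?_ (fun z => if h : T.IsLeaf z then f ⟨z, h⟩ else 0) ?_ ?_ ?_
  · intro h
    rw [h] at h0
    have h2 := congrArg T.level h0
    rw [T.level_iter] at h2
    have h3 : T.level (v (k - 1)) = 0 := by omega
    have := T.iter_level (v (k - 1))
    rwa [h3] at this
  · intro x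
    split_ifs with h
    · exact hfnn _
    · exact le_rfl
  · rw [dif_pos hw2l]
    apply hfpos
    exact (T.anc_step _ _).2 (Or.inr (by rw [hw2]; exact T.anc_refl _))
  · intro y hy
    have := congrFun hfeig ⟨y, hy⟩
    rw [← hfe, T.mulVec_eq (fun z => if h : T.IsLeaf z then f ⟨z, h⟩ else 0)] at this
    rw [this]
    rfl
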